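/- Let n ≥ 2 and let Y be an unbounded closed subset of ℝ^{n+1}. Then the set of restrictions to Y × S^n of smooth compactly supported functions on ℝ^{n+1} × ℝ^{n+1} whose support meets Y × S^n in a compact set is dense in 𝔜₀(Y) with respect to the norm ‖·‖_𝔜. -/

import Mathlib

/- Function spaces 𝔚, 𝔛, 𝔜′, 𝔜₀, 𝔜 on `Y × 𝕊ⁿ` from Bernstein–Wang,
"A mountain-pass theorem for asymptotically conical self-expanders". -/

noncomputable section

open Set Metric Real Filter
open scoped RealInnerProductSpace

/-- `ℝ^{n+1}` as a Euclidean space. -/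
abbrev Euc (n : ℕ) : Type := EuclideanSpace ℝ (Fin (n + 1))

/-- The unit sphere `𝕊ⁿ ⊆ ℝ^{n+1}`. -/
def Sph (n : ℕ) : Set (Euc n) := Metric.sphere (0 : Euc n) 1

/-- The set `Y × 𝕊ⁿ` inside `ℝ^{n+1} × ℝ^{n+1}`. -/
def pts {n : ℕ} (Y : Set (Euc n)) : Set (Euc n × Euc n) := Y ×ˢ Sph n

/-- The weight `(1+|p|)^{n+1} e^{|p|²/4}` appearing in the 𝔚-norm. -/
def wWeight (n : ℕ) (p : Euc n) : ℝ := (1 + ‖p‖) ^ (n + 1) * Real.exp (‖p‖ ^ 2 / 4)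

/-- The 𝔚-norm `sup (1+|p|)^{n+1} e^{|p|²/4} |ψ|` over `Y × 𝕊ⁿ`. -/
def WNorm {n : ℕ} (Y : Set (Euc n)) (ψ : Euc n × Euc n → ℝ) : ℝ :=
  sSup ((fun x => wWeight n x.1 * |ψ x|) '' pts Y)

/-- Membership in the space 𝔚(Y) of rapidly decaying continuous functions. -/
def memW {n : ℕ} (Y : Set (Euc n)) (ψ : Euc n × Euc n → ℝ) : Prop :=
  ContinuousOn ψ (pts Y) ∧ ∃ M : ℝ, ∀ x ∈ pts Y, wWeight n x.1 * |ψ x| ≤ M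

/-- Supremum norm over `Y × 𝕊ⁿ`. -/
def nsup {n : ℕ} {F : Type*} [NormedAddCommGroup F] (Y : Set (Euc n))
    (f : Euc n × Euc n → F) : ℝ :=
  sSup ((fun x => ‖f x‖) '' pts Y)

/-- The set of Lipschitz constants of `f` on `Y × 𝕊ⁿ` (with the metric induced from
`ℝ^{n+1} × ℝ^{n+1}`). -/
def lipSet {n : ℕ} {F : Type*} [NormedAddCommGroup F] (Y : Set (Euc n))
    (f : Euc n × Euc n → F) : Set ℝ :=
  {K : ℝ | 0 ≤ K ∧ ∀ x ∈ pts Y, ∀ y ∈ pts Y, ‖f x - f y‖ ≤ K * dist x y}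

/-- The Lipschitz norm `‖f‖_{Lip}`: sup norm plus best Lipschitz constant. -/
def LipNorm {n : ℕ} {F : Type*} [NormedAddCommGroup F] (Y : Set (Euc n))
    (f : Euc n × Euc n → F) : ℝ :=
  nsup Y f + sInf (lipSet Y f)

/-- `f` is bounded and Lipschitz on `Y × 𝕊ⁿ`. -/
def IsBddLip {n : ℕ} {F : Type*} [NormedAddCommGroup F] (Y : Set (Euc n))
    (f : Euc n × Euc n → F) : Prop :=
  (∃ M : ℝ, ∀ x ∈ pts Y, ‖f x‖ ≤ M) ∧ (lipSet Y f).Nonempty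

/-- `g` is the spherical gradient `∇_{𝕊ⁿ} ψ` on `Y × 𝕊ⁿ`: at each `(p,v) ∈ Y × 𝕊ⁿ`,
`g(p,v)` is orthogonal to `v` and is the gradient of `ψ(p,·)` at `v` along the sphere. -/
def IsSphereGrad {n : ℕ} (Y : Set (Euc n)) (ψ : Euc n × Euc n → ℝ)
    (g : Euc n × Euc n → Euc n) : Prop :=
  ∀ x ∈ pts Y,
    ⟪g x, x.2⟫ = 0 ∧
    HasFDerivWithinAt (fun v => ψ (x.1, v)) (innerSL ℝ (g x)) (Sph n) x.2

/-- The weighted gradient supremum `sup (1+|p|)|∇_{𝕊ⁿ}ψ|`. -/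
def gradWsup {n : ℕ} (Y : Set (Euc n)) (g : Euc n × Euc n → Euc n) : ℝ :=
  sSup ((fun x => (1 + ‖x.1‖) * ‖g x‖) '' pts Y)

/-- Membership in the space 𝔛(Y). -/
def memX {n : ℕ} (Y : Set (Euc n)) (ψ : Euc n × Euc n → ℝ) : Prop :=
  IsBddLip Y ψ ∧ ∃ g : Euc n × Euc n → Euc n, IsSphereGrad Y ψ g ∧ IsBddLip Y g ∧
    ∃ M : ℝ, ∀ x ∈ pts Y, (1 + ‖x.1‖) * ‖g x‖ ≤ M

/-- The 𝔛-norm `‖ψ‖_𝔛 = ‖ψ‖_{Lip} + ‖∇_{𝕊ⁿ}ψ‖_{Lip} + sup (1+|p|)|∇_{𝕊ⁿ}ψ|`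
(as an infimum over representatives of the spherical gradient). -/
def XNorm {n : ℕ} (Y : Set (Euc n)) (ψ : Euc n × Euc n → ℝ) : ℝ :=
  sInf {r : ℝ | ∃ g : Euc n × Euc n → Euc n, IsSphereGrad Y ψ g ∧
    r = LipNorm Y ψ + LipNorm Y g + gradWsup Y g}

/-- Membership in `𝔜′(Y) = 𝔛(Y) + 𝔚(Y)` (equality of functions on `Y × 𝕊ⁿ`). -/
def memYp {n : ℕ} (Y : Set (Euc n)) (ψ : Euc n × Euc n → ℝ) : Prop :=
  ∃ ζ ξ : Euc n × Euc n → ℝ, memX Y ζ ∧ memW Y ξ ∧ ∀ x ∈ pts Y, ψ x = ζ x + ξ x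

/-- The 𝔜-norm `‖ψ‖_𝔜 = inf {‖ζ‖_𝔛 + ‖ξ‖_𝔚 : ψ = ζ + ξ}`. -/
def YNorm {n : ℕ} (Y : Set (Euc n)) (ψ : Euc n × Euc n → ℝ) : ℝ :=
  sInf {r : ℝ | ∃ ζ ξ : Euc n × Euc n → ℝ, memX Y ζ ∧ memW Y ξ ∧
    (∀ x ∈ pts Y, ψ x = ζ x + ξ x) ∧ r = XNorm Y ζ + WNorm Y ξ}

/-- Continuous compactly supported functions on `Y × 𝕊ⁿ`. -/
def memCc {n : ℕ} (Y : Set (Euc n)) (φ : Euc n × Euc n → ℝ) : Prop :=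
  ContinuousOn φ (pts Y) ∧
    ∃ K : Set (Euc n × Euc n), IsCompact K ∧ ∀ x ∈ pts Y, x ∉ K → φ x = 0

/-- Membership in `𝔜₀(Y)`: the closure of `C⁰_c(Y × 𝕊ⁿ)` in `𝔜′(Y)`. -/
def memY0 {n : ℕ} (Y : Set (Euc n)) (ψ : Euc n × Euc n → ℝ) : Prop :=
  memYp Y ψ ∧ ∀ ε : ℝ, 0 < ε → ∃ φ, memCc Y φ ∧ YNorm Y (fun x => ψ x - φ x) < ε

/-- Membership in `𝔜(Y) = ℝ·𝟙 ⊕ 𝔜₀(Y)`. -/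
def memY {n : ℕ} (Y : Set (Euc n)) (ψ : Euc n × Euc n → ℝ) : Prop :=
  ∃ (c : ℝ) (φ : Euc n × Euc n → ℝ), memY0 Y φ ∧ ∀ x ∈ pts Y, ψ x = c + φ x

theorem wWeight_pos (n : ℕ) (p : Euc n) : 0 < wWeight n p := by
  unfold wWeight; positivity

theorem wWeight_cont (n : ℕ) : Continuous (fun x : Euc n × Euc n => wWeight n x.1) := by
  unfold wWeight; fun_prop

theorem pts_closed {n : ℕ} {Y : Set (Euc n)} (hY : IsClosed Y) : IsClosed (pts Y) :=
  hY.prod Metric.isClosed_sphere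

theorem memW_of_cc {n : ℕ} (Y : Set (Euc n)) (f : Euc n × Euc n → ℝ) (hf : Continuous f)
    (hc : HasCompactSupport f) : memW Y f := by
  refine ⟨hf.continuousOn, ?_⟩
  have h1 : Continuous (fun x : Euc n × Euc n => wWeight n x.1 * f x) := (wWeight_cont n).mul hf
  obtain ⟨C, hC⟩ := h1.bounded_above_of_compact_support (hc.mul_left)
  refine ⟨C, fun x _ => ?_⟩
  have := hC x
  rwa [Real.norm_eq_abs, abs_mul, abs_of_pos (wWeight_pos n x.1)] at this

theorem WNorm_nonneg' {n : ℕ} (Y : Set (Euc n)) (f : Euc n × Euc n → ℝ) : 0 ≤ WNorm Y f := by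
  apply Real.sSup_nonneg
  rintro _ ⟨x, _, rfl⟩
  exact mul_nonneg (wWeight_pos n x.1).le (abs_nonneg _)

theorem LipNorm_nonneg' {n : ℕ} {F : Type*} [NormedAddCommGroup F] (Y : Set (Euc n))
    (f : Euc n × Euc n → F) : 0 ≤ LipNorm Y f := by
  refine add_nonneg (Real.sSup_nonneg ?_) (Real.sInf_nonneg ?_)
  · rintro _ ⟨x, _, rfl⟩
    exact norm_nonneg _
  · intro K hK
    exact hK.1

theorem XNorm_nonneg' {n : ℕ} (Y : Set (Euc n)) (f : Euc n × Euc n → ℝ) : 0 ≤ XNorm Y f := by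
  apply Real.sInf_nonneg
  rintro _ ⟨g, _, rfl⟩
  refine add_nonneg (add_nonneg (LipNorm_nonneg' _ _) (LipNorm_nonneg' _ _)) (Real.sSup_nonneg ?_)
  rintro _ ⟨x, _, rfl⟩
  exact mul_nonneg (by positivity) (norm_nonneg _)

theorem memW_add' {n : ℕ} {Y : Set (Euc n)} {f g : Euc n × Euc n → ℝ} (hf : memW Y f)
    (hg : memW Y g) : memW Y (fun x => f x + g x) := by
  obtain ⟨cf, M, hM⟩ := hf
  obtain ⟨cg, N, hN⟩ := hg
  refine ⟨cf.add cg, M + N, fun x hx => ?_⟩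
  have h1 := hM x hx
  have h2 := hN x hx
  have h3 := mul_le_mul_of_nonneg_left (abs_add_le (f x) (g x)) (wWeight_pos n x.1).le
  linarith

theorem WNorm_add_le' {n : ℕ} {Y : Set (Euc n)} {f g : Euc n × Euc n → ℝ} (hf : memW Y f)
    (δ : ℝ) (hδ : 0 ≤ δ) (hg : ∀ x ∈ pts Y, wWeight n x.1 * |g x| ≤ δ) :
    WNorm Y (fun x => f x + g x) ≤ WNorm Y f + δ := by
  obtain ⟨cf, M, hM⟩ := hf
  refine Real.sSup_le ?_ (add_nonneg (WNorm_nonneg' _ _) hδ)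
  rintro _ ⟨x, hx, rfl⟩
  have h1 : wWeight n x.1 * |f x| ≤ WNorm Y f :=
    le_csSup ⟨M, by rintro _ ⟨y, hy, rfl⟩; exact hM y hy⟩ ⟨x, hx, rfl⟩
  have h2 := hg x hx
  have h3 := mul_le_mul_of_nonneg_left (abs_add_le (f x) (g x)) (wWeight_pos n x.1).le
  simp only
  linarith

theorem memCc_extend {n : ℕ} {Y : Set (Euc n)} (hY : IsClosed Y) {φ : Euc n × Euc n → ℝ}
    (hφ : memCc Y φ) : ∃ f : Euc n × Euc n → ℝ, Continuous f ∧ HasCompactSupport f ∧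
      ∀ x ∈ pts Y, f x = φ x := by
  obtain ⟨hc, K, hK, hK0⟩ := hφ
  obtain ⟨Φ, hΦ⟩ := ContinuousMap.exists_restrict_eq (pts_closed hY)
    ⟨(pts Y).domRestrict φ, continuousOn_iff_continuous_domRestrict.1 hc⟩
  have hΦ' : ∀ x ∈ pts Y, Φ x = φ x := fun x hx => by
    have := congrArg (fun h => h ⟨x, hx⟩) hΦ
    exact this
  obtain ⟨R, hR⟩ := hK.isBounded.subset_closedBall (0 : Euc n × Euc n)
  refine ⟨fun x => Φ x * max 0 (min 1 (R + 1 - ‖x‖)), by fun_prop, ?_, ?_⟩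
  · refine HasCompactSupport.intro (isCompact_closedBall (0 : Euc n × Euc n) (R + 1)) ?_
    intro x hx
    have h : R + 1 < ‖x‖ := by simpa using hx
    have : max 0 (min 1 (R + 1 - ‖x‖)) = 0 :=
      max_eq_left ((min_le_right _ _).trans (by linarith))
    simp only [this, mul_zero]
  · intro x hx
    simp only [hΦ' x hx]
    by_cases hxK : x ∈ K
    · have h : ‖x‖ ≤ R := by simpa using hR hxK
      rw [min_eq_left (by linarith), max_eq_right (by norm_num), mul_one]
    · rw [hK0 x hx hxK, zero_mul]

theorem approx' {n : ℕ} (f : Euc n × Euc n → ℝ) (hf : Continuous f) (δ : ℝ) (hδ : 0 < δ) :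
    ∃ Ψ : Euc n × Euc n → ℝ, ContDiff ℝ (⊤ : ℕ∞) Ψ ∧
      (∀ x, dist (Ψ x) (f x) < δ / wWeight n x.1) ∧
      Function.support Ψ ⊆ Function.support f := by
  have h1 : Continuous (fun x : Euc n × Euc n => δ / wWeight n x.1) :=
    continuous_const.div (wWeight_cont n) (fun x => (wWeight_pos n x.1).ne')
  have h2 : ∀ x : Euc n × Euc n, 0 < δ / wWeight n x.1 :=
    fun x => div_pos hδ (wWeight_pos n x.1)
  exact Continuous.exists_contDiff_approx (E := Euc n × Euc n) (F := ℝ) ⊤ hf h1 h2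

/-- For `n ≥ 2` and `Y ⊆ ℝ^{n+1}` unbounded and closed, restrictions to
`Y × 𝕊ⁿ` of smooth compactly supported functions on `ℝ^{n+1} × ℝ^{n+1}` are dense in
`𝔜₀(Y)` for the 𝔜-norm. -/
theorem smooth_compactly_supported_dense_in_Y0
    (n : ℕ) (hn : 2 ≤ n) (Y : Set (Euc n)) (hYclosed : IsClosed Y)
    (hYunbounded : ¬ Bornology.IsBounded Y)
    (ψ : Euc n × Euc n → ℝ) (hψ : memY0 Y ψ) :
    ∀ ε : ℝ, 0 < ε → ∃ Ψ : Euc n × Euc n → ℝ,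
      ContDiff ℝ (⊤ : ℕ∞) Ψ ∧ HasCompactSupport Ψ ∧
      IsCompact (tsupport Ψ ∩ pts Y) ∧
      YNorm Y (fun x => ψ x - Ψ x) < ε := by
  intro ε hε
  obtain ⟨⟨ζ₀, ξ₀, hζ₀, hξ₀, hψ₀⟩, hcl⟩ := hψ
  obtain ⟨φ, hφ, hlt⟩ := hcl (ε / 2) (by linarith)
  obtain ⟨f, hf, hfc, hfφ⟩ := memCc_extend hYclosed hφ
  obtain ⟨Ψ, hΨ, hd, hs⟩ := approx' f hf (ε / 2) (by linarith)
  have hΨc : HasCompactSupport Ψ := hfc.mono hs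
  refine ⟨Ψ, hΨ, hΨc, hΨc.isCompact.inter_right (pts_closed hYclosed), ?_⟩
  have hne : {r : ℝ | ∃ ζ ξ : Euc n × Euc n → ℝ, memX Y ζ ∧ memW Y ξ ∧
      (∀ x ∈ pts Y, ψ x - φ x = ζ x + ξ x) ∧ r = XNorm Y ζ + WNorm Y ξ}.Nonempty := by
    refine ⟨_, ζ₀, fun x => ξ₀ x + -f x, hζ₀,
      memW_add' hξ₀ (memW_of_cc Y (fun x => -f x) hf.neg hfc.neg), ?_, rfl⟩
    intro x hx
    simp only [hψ₀ x hx, hfφ x hx]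
    ring
  obtain ⟨_, ⟨ζ, ξ, hζ, hξ, heq, rfl⟩, hr⟩ := exists_lt_of_csInf_lt hne hlt
  have hg : memW Y (fun x => f x - Ψ x) :=
    memW_of_cc Y _ (hf.sub hΨ.continuous) (hfc.sub hΨc)
  have hgb : ∀ x ∈ pts Y, wWeight n x.1 * |f x - Ψ x| ≤ ε / 2 := by
    intro x _
    have h := hd x
    rw [dist_comm, Real.dist_eq, lt_div_iff₀ (wWeight_pos n x.1)] at h
    linarith
  have hW := WNorm_add_le' hξ (ε / 2) (by linarith) hgb
  have hle : YNorm Y (fun x => ψ x - Ψ x) ≤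
      XNorm Y ζ + WNorm Y (fun x => ξ x + (f x - Ψ x)) := by
    refine csInf_le ⟨0, ?_⟩ ⟨ζ, _, hζ, memW_add' hξ hg, ?_, rfl⟩
    · rintro _ ⟨a, b, _, _, _, rfl⟩
      exact add_nonneg (XNorm_nonneg' _ _) (WNorm_nonneg' _ _)
    · intro x hx
      have := heq x hx
      rw [← hfφ x hx] at this
      linarith
  linarith
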